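/- arXiv:1703.02251 — 2 statements merged into one kernel-verified Lean document; each statement's English description precedes it below -/
import Mathlib

section
/- Let A be the 6×8 integer matrix of the binary no-three-way interaction (3-cycle) model described in the context. For every c ∈ (ℂ*)^8 there is a nonzero polynomial G ∈ ℂ[u] such that for every u ∈ ℂ^8 with G(u) ≠ 0 the likelihood system for (A,c,u) has exactly 4 solutions if c_{000}c_{011}c_{101}c_{110} − c_{001}c_{010}c_{100}c_{111} ≠ 0, and exactly 3 solutions if c_{000}c_{011}c_{101}c_{110} − c_{001}c_{010}c_{100}c_{111} = 0. (The ML degree of the scaled binary 3-cycle is 4 unless c lies on the principal A-determinant, in which case it is 3.) -/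
open scoped BigOperators

/-- The likelihood system for a matrix `A`, scaling `c` and data `u`. -/
def mlSolutions {κ ι : Type*} [Fintype κ] [Fintype ι] (A : κ → ι → ℤ)
    (c u : ι → ℂ) : Set (ι → ℂ) :=
  {p | (∀ j, p j ≠ 0) ∧
    (∀ v : ι → ℤ, (∀ i, ∑ j, A i j * v j = 0) → (∑ j, v j = 0) →
      (∏ j, p j ^ (max (v j) 0).toNat) = (∏ j, p j ^ (max (-v j) 0).toNat)) ∧
    (∑ j, c j * p j = 1) ∧
    (∀ i, (∑ j, u j) * (∑ j, (A i j : ℂ) * (c j * p j)) = ∑ j, (A i j : ℂ) * u j)}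

/-- The `6 × 8` matrix of the binary no-three-way interaction (3-cycle) model:
the column indexed by `(i,j,k) ∈ {0,1}³` is `(i, j, k, ij, ik, jk)ᵀ`. -/
def cycleA : Fin 6 → (Fin 2 × Fin 2 × Fin 2) → ℤ :=
  ![fun t => ((t.1 : ℕ) : ℤ),
    fun t => ((t.2.1 : ℕ) : ℤ),
    fun t => ((t.2.2 : ℕ) : ℤ),
    fun t => ((t.1 : ℕ) : ℤ) * ((t.2.1 : ℕ) : ℤ),
    fun t => ((t.1 : ℕ) : ℤ) * ((t.2.2 : ℕ) : ℤ),
    fun t => ((t.2.1 : ℕ) : ℤ) * ((t.2.2 : ℕ) : ℤ)]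

open Polynomial in
/-- A polynomial over `MvPolynomial σ K` that specializes at one point to a separable polynomial of
degree `d` has exactly `d` roots after specialization at a generic point. -/
theorem exists_generic_card_roots_eq {σ K : Type*} [Field K] [CharZero K] [IsAlgClosed K]
    (F : (MvPolynomial σ K)[X]) {d : ℕ} (hd : d ≠ 0) (hF : F.natDegree ≤ d) (u₀ : σ → K)
    (hdeg : (F.map (MvPolynomial.eval u₀)).natDegree = d)
    (hsep : (F.map (MvPolynomial.eval u₀)).Separable) :
    ∃ G : MvPolynomial σ K, G ≠ 0 ∧ ∀ u : σ → K, MvPolynomial.eval u G ≠ 0 →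
      F.map (MvPolynomial.eval u) ≠ 0 ∧
        ((F.map (MvPolynomial.eval u)).rootSet K).ncard = d := by
  have hF' : F.derivative.natDegree ≤ d - 1 := (natDegree_derivative_le F).trans (by omega)
  have hres : F.resultant F.derivative d (d - 1) ≠ 0 := by
    intro h
    have h1 := resultant_map_map F F.derivative d (d - 1) (MvPolynomial.eval u₀)
    rw [h, map_zero, ← derivative_map] at h1
    refine resultant_ne_zero _ _ hsep ?_
    rw [natDegree_derivative, hdeg]
    exact h1
  have hlead : F.coeff d ≠ 0 := by
    intro h
    have h1 : (F.map (MvPolynomial.eval u₀)).coeff d = 0 := by rw [coeff_map, h, map_zero]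
    rw [← hdeg, coeff_natDegree, leadingCoeff_eq_zero] at h1
    rw [h1, natDegree_zero] at hdeg
    exact hd hdeg.symm
  refine ⟨_, mul_ne_zero hres hlead, fun u hu ↦ ?_⟩
  rw [map_mul] at hu
  obtain ⟨hu1, hu2⟩ := mul_ne_zero_iff.mp hu
  have hsepu : (F.map (MvPolynomial.eval u)).Separable := by
    obtain ⟨p, q, -, -, hpq⟩ :=
      exists_mul_add_mul_eq_C_resultant F F.derivative hF hF' (Or.inl hd)
    have h1 := congrArg (Polynomial.map (MvPolynomial.eval u)) hpq
    rw [Polynomial.map_add, Polynomial.map_mul, Polynomial.map_mul, map_C, ← derivative_map] at h1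
    set r := MvPolynomial.eval u (F.resultant F.derivative d (d - 1))
    refine ⟨C r⁻¹ * p.map (MvPolynomial.eval u), C r⁻¹ * q.map (MvPolynomial.eval u), ?_⟩
    have h2 : (C r⁻¹ * C r : K[X]) = 1 := by rw [← C_mul, inv_mul_cancel₀ hu1, C_1]
    linear_combination C r⁻¹ * h1 + h2
  have hdegu : (F.map (MvPolynomial.eval u)).natDegree = d := by
    refine natDegree_eq_of_le_of_coeff_ne_zero (natDegree_map_le.trans hF) ?_
    rwa [coeff_map]
  refine ⟨hsepu.ne_zero, ?_⟩
  rw [← Nat.card_coe_set_eq, Nat.card_eq_fintype_card,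
    card_rootSet_eq_natDegree hsepu (IsAlgClosed.splits _), hdegu]

open Polynomial in
/-- The polynomial in `s` cutting out the toric hypersurface on the line of tables
`u + s • (1, -1, -1, 1, -1, 1, 1, -1)`, with weights `a` and `b` on the two monomials. -/
noncomputable def cyclePoly {R : Type*} [CommRing R] (a b : R) (u : Fin 2 × Fin 2 × Fin 2 → R) :
    R[X] :=
  C a * ((X + C (u (0, 0, 0))) * (X + C (u (0, 1, 1))) * (X + C (u (1, 0, 1))) *
      (X + C (u (1, 1, 0)))) -
    C b * ((C (u (0, 0, 1)) - X) * (C (u (0, 1, 0)) - X) * (C (u (1, 0, 0)) - X) *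
      (C (u (1, 1, 1)) - X))

theorem map_cyclePoly {R S : Type*} [CommRing R] [CommRing S] (φ : R →+* S) (a b : R)
    (u : Fin 2 × Fin 2 × Fin 2 → R) :
    (cyclePoly a b u).map φ = cyclePoly (φ a) (φ b) (fun t ↦ φ (u t)) := by
  simp [cyclePoly]

theorem natDegree_cyclePoly_le {R : Type*} [CommRing R] (a b : R)
    (u : Fin 2 × Fin 2 × Fin 2 → R) : (cyclePoly a b u).natDegree ≤ 4 := by
  unfold cyclePoly
  compute_degree

open Polynomial in
theorem natDegree_cyclePoly_self_le {R : Type*} [CommRing R] (a : R)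
    (u : Fin 2 × Fin 2 × Fin 2 → R) : (cyclePoly a a u).natDegree ≤ 3 := by
  have h : ∀ x₁ x₂ x₃ x₄ y₁ y₂ y₃ y₄ : R,
      (C a * ((X + C x₁) * (X + C x₂) * (X + C x₃) * (X + C x₄)) -
        C a * ((C y₁ - X) * (C y₂ - X) * (C y₃ - X) * (C y₄ - X))).natDegree ≤ 3 := by
    intro x₁ x₂ x₃ x₄ y₁ y₂ y₃ y₄
    have h1 : C a * ((X + C x₁) * (X + C x₂) * (X + C x₃) * (X + C x₄)) -
        C a * ((C y₁ - X) * (C y₂ - X) * (C y₃ - X) * (C y₄ - X)) =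
        C (a * (x₁ + x₂ + x₃ + x₄ + y₁ + y₂ + y₃ + y₄)) * X ^ 3 +
        C (a * (x₁ * x₂ + x₁ * x₃ + x₁ * x₄ + x₂ * x₃ + x₂ * x₄ + x₃ * x₄ -
          (y₁ * y₂ + y₁ * y₃ + y₁ * y₄ + y₂ * y₃ + y₂ * y₄ + y₃ * y₄))) * X ^ 2 +
        C (a * (x₁ * x₂ * x₃ + x₁ * x₂ * x₄ + x₁ * x₃ * x₄ + x₂ * x₃ * x₄ +
          (y₁ * y₂ * y₃ + y₁ * y₂ * y₄ + y₁ * y₃ * y₄ + y₂ * y₃ * y₄))) * X +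
        C (a * (x₁ * x₂ * x₃ * x₄ - y₁ * y₂ * y₃ * y₄)) := by
      simp only [C_mul, C_add, C_sub]
      ring
    rw [h1]
    compute_degree
  exact h _ _ _ _ _ _ _ _

/-- The table equal to `0` where `i + j + k` is even and to `1` where it is odd. -/
def parityTable (R : Type*) [CommRing R] (t : Fin 2 × Fin 2 × Fin 2) : R :=
  ((((t.1 : ℕ) + (t.2.1 : ℕ) + (t.2.2 : ℕ)) % 2 : ℕ) : R)

open Polynomial in
theorem cyclePoly_parityTable {R : Type*} [CommRing R] (a b : R) :
    cyclePoly a b (parityTable R) = C a * X ^ 4 - C b * (1 - X) ^ 4 := by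
  simp [cyclePoly, parityTable]
  ring

open Polynomial in
theorem separable_cyclePoly_parityTable {K : Type*} [Field K] [CharZero K] {a b : K}
    (ha : a ≠ 0) (hb : b ≠ 0) : (cyclePoly a b (parityTable K)).Separable := by
  rw [cyclePoly_parityTable]
  have hd : derivative (C a * X ^ 4 - C b * (1 - X) ^ 4) =
      4 * (C a * X ^ 3) + 4 * (C b * (1 - X) ^ 3) := by
    simp only [derivative_sub, derivative_C_mul, derivative_pow, derivative_X, derivative_one,
      C_ofNat, Nat.cast_ofNat]
    ring
  have h4 : (C (4⁻¹ : K) * 4 : K[X]) = 1 := by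
    rw [← C_ofNat, ← C_mul, inv_mul_cancel₀ (by norm_num), C_1]
  have hx : (C a⁻¹ * C a : K[X]) = 1 := by rw [← C_mul, inv_mul_cancel₀ ha, C_1]
  have hy : (C b⁻¹ * C b : K[X]) = 1 := by rw [← C_mul, inv_mul_cancel₀ hb, C_1]
  obtain ⟨p, q, hpq⟩ : IsCoprime (X ^ 3 : K[X]) ((1 - X) ^ 3) :=
    IsCoprime.pow ⟨1, 1, by ring⟩
  rw [Separable, hd]
  set f : K[X] := C a * X ^ 4 - C b * (1 - X) ^ 4 with hf
  set g : K[X] := 4 * (C a * X ^ 3) + 4 * (C b * (1 - X) ^ 3) with hg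
  have h1 : X ^ 3 = C a⁻¹ * C 4⁻¹ * (4 * f + (1 - X) * g) := by
    rw [hf, hg]
    linear_combination (-(C a⁻¹ * C a * X ^ 3)) * h4 - X ^ 3 * hx
  have h2 : (1 - X) ^ 3 = C b⁻¹ * C 4⁻¹ * (X * g - 4 * f) := by
    rw [hf, hg]
    linear_combination (-(C b⁻¹ * C b * (1 - X) ^ 3)) * h4 - (1 - X) ^ 3 * hy
  refine ⟨p * (C a⁻¹ * C 4⁻¹) * 4 - q * (C b⁻¹ * C 4⁻¹) * 4,
    p * (C a⁻¹ * C 4⁻¹) * (1 - X) + q * (C b⁻¹ * C 4⁻¹) * X, ?_⟩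
  linear_combination hpq - p * h1 - q * h2

open Polynomial in
theorem natDegree_cyclePoly_parityTable_of_ne {K : Type*} [Field K] {a b : K}
    (hab : a ≠ b) : (cyclePoly a b (parityTable K)).natDegree = 4 := by
  have h : cyclePoly a b (parityTable K) =
      C (a - b) * X ^ 4 + C (4 * b) * X ^ 3 + C (-6 * b) * X ^ 2 + C (4 * b) * X + C (-b) := by
    rw [cyclePoly_parityTable]
    simp only [C_mul, C_sub, C_neg, C_ofNat]
    ring
  rw [h]
  have := sub_ne_zero.mpr hab
  compute_degree!

open Polynomial in
theorem natDegree_cyclePoly_parityTable_self {K : Type*} [Field K] [CharZero K] {a : K}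
    (ha : a ≠ 0) : (cyclePoly a a (parityTable K)).natDegree = 3 := by
  have h : cyclePoly a a (parityTable K) =
      C (4 * a) * X ^ 3 + C (-6 * a) * X ^ 2 + C (4 * a) * X + C (-a) := by
    rw [cyclePoly_parityTable]
    simp only [C_mul, C_neg, C_ofNat]
    ring
  rw [h]
  compute_degree!

/-- For nonzero weights, `cyclePoly` has generically four roots, and three if the weights agree. -/
theorem exists_generic_card_rootSet_cyclePoly {K : Type*} [Field K] [CharZero K] [IsAlgClosed K]
    {a b : K} (ha : a ≠ 0) (hb : b ≠ 0) :
    ∃ G : MvPolynomial (Fin 2 × Fin 2 × Fin 2) K, G ≠ 0 ∧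
      ∀ u : Fin 2 × Fin 2 × Fin 2 → K, MvPolynomial.eval u G ≠ 0 →
        cyclePoly a b u ≠ 0 ∧
        (a ≠ b → ((cyclePoly a b u).rootSet K).ncard = 4) ∧
        (a = b → ((cyclePoly a b u).rootSet K).ncard = 3) := by
  set F := cyclePoly (MvPolynomial.C a) (MvPolynomial.C b)
    (MvPolynomial.X (R := K) : Fin 2 × Fin 2 × Fin 2 → _) with hFdef
  have hF (u : Fin 2 × Fin 2 × Fin 2 → K) :
      F.map (MvPolynomial.eval u) = cyclePoly a b u := by
    rw [hFdef, map_cyclePoly]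
    simp
  have hsep := separable_cyclePoly_parityTable ha hb
  rw [← hF] at hsep
  rcases eq_or_ne a b with rfl | hab
  · obtain ⟨G, hG, h⟩ := exists_generic_card_roots_eq F three_ne_zero
      (natDegree_cyclePoly_self_le _ _) _
      (by rw [hF, natDegree_cyclePoly_parityTable_self ha]) hsep
    refine ⟨G, hG, fun u hu ↦ ?_⟩
    obtain ⟨h1, h2⟩ := h u hu
    rw [hF] at h1 h2
    exact ⟨h1, fun h ↦ (h rfl).elim, fun _ ↦ h2⟩
  · obtain ⟨G, hG, h⟩ := exists_generic_card_roots_eq F four_ne_zero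
      (natDegree_cyclePoly_le _ _ _) _
      (by rw [hF, natDegree_cyclePoly_parityTable_of_ne hab]) hsep
    refine ⟨G, hG, fun u hu ↦ ?_⟩
    obtain ⟨h1, h2⟩ := h u hu
    rw [hF] at h1 h2
    exact ⟨h1, fun _ ↦ h2, fun h ↦ (hab h).elim⟩

/-- The likelihood system of the binary 3-cycle, written out. -/
theorem mem_mlSolutions_cycleA_iff (c u p : Fin 2 × Fin 2 × Fin 2 → ℂ) :
    p ∈ mlSolutions cycleA c u ↔ (∀ t, p t ≠ 0) ∧
      p (0, 0, 0) * p (0, 1, 1) * p (1, 0, 1) * p (1, 1, 0) =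
        p (0, 0, 1) * p (0, 1, 0) * p (1, 0, 0) * p (1, 1, 1) ∧
      (∑ t, c t * p t = 1) ∧
      (∀ i, (∑ t, u t) * (∑ t, (cycleA i t : ℂ) * (c t * p t)) = ∑ t, (cycleA i t : ℂ) * u t) := by
  refine and_congr_right fun _ ↦ and_congr_left fun _ ↦ ⟨fun h ↦ ?_, fun h v hA hv ↦ ?_⟩
  · have := h (fun t ↦ (-1) ^ ((t.1 : ℕ) + (t.2.1 : ℕ) + (t.2.2 : ℕ)))
      (by
        intro i
        fin_cases i <;> simp [cycleA, Fintype.sum_prod_type])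
      (by simp [Fintype.sum_prod_type])
    simp [Fintype.prod_prod_type] at this
    linear_combination this
  · simp only [Fin.forall_fin_succ, cycleA, Fintype.sum_prod_type] at hA
    simp [Fin.sum_univ_succ] at hA
    simp [Fintype.sum_prod_type] at hv
    obtain ⟨h1, h2, h3, h4, h5, h6⟩ := hA
    have e1 : v (0, 0, 1) = - v (0, 0, 0) := by linarith
    have e2 : v (0, 1, 0) = - v (0, 0, 0) := by linarith
    have e3 : v (0, 1, 1) = v (0, 0, 0) := by linarith
    have e4 : v (1, 0, 0) = - v (0, 0, 0) := by linarith
    have e5 : v (1, 0, 1) = v (0, 0, 0) := by linarith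
    have e6 : v (1, 1, 0) = v (0, 0, 0) := by linarith
    have e7 : v (1, 1, 1) = - v (0, 0, 0) := by linarith
    simp only [Fintype.prod_prod_type, Fin.prod_univ_two, e1, e2, e3, e4, e5, e6, e7, neg_neg]
    generalize (max (v (0, 0, 0)) 0).toNat = m
    generalize (max (-v (0, 0, 0)) 0).toNat = n
    have hm := congrArg (· ^ m) h
    have hn := congrArg (· ^ n) h
    simp only [mul_pow] at hm hn
    calc _ = (p (0, 0, 0) ^ m * p (0, 1, 1) ^ m * p (1, 0, 1) ^ m * p (1, 1, 0) ^ m) *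
          (p (0, 0, 1) ^ n * p (0, 1, 0) ^ n * p (1, 0, 0) ^ n * p (1, 1, 1) ^ n) := by ring
      _ = _ := by rw [hm, ← hn]; ring

/-- The sign `(-1) ^ (i + j + k)`. -/
def paritySign (t : Fin 2 × Fin 2 × Fin 2) : ℂ :=
  (-1) ^ ((t.1 : ℕ) + (t.2.1 : ℕ) + (t.2.2 : ℕ))

/-- The points `p` for which `c * p` has the margins of `u / ∑ u`, parametrized by a line. -/
noncomputable def cycleFiber (c u : Fin 2 × Fin 2 × Fin 2 → ℂ) (s : ℂ)
    (t : Fin 2 × Fin 2 × Fin 2) : ℂ :=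
  (u t + paritySign t * s) / (c t * ∑ t, u t)

theorem cycleFiber_injective {c u : Fin 2 × Fin 2 × Fin 2 → ℂ} (hc : ∀ t, c t ≠ 0)
    (hu : ∑ t, u t ≠ 0) : Function.Injective (cycleFiber c u) := by
  intro s s' h
  have h0 := congrFun h (0, 0, 0)
  simp only [cycleFiber, paritySign] at h0
  rw [div_left_inj' (mul_ne_zero (hc _) hu)] at h0
  simpa using h0

theorem cycleFiber_margins {c u : Fin 2 × Fin 2 × Fin 2 → ℂ} (hc : ∀ t, c t ≠ 0)
    (hu : ∑ t, u t ≠ 0) (s : ℂ) :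
    (∑ t, c t * cycleFiber c u s t = 1) ∧
      ∀ i, (∑ t, u t) * (∑ t, (cycleA i t : ℂ) * (c t * cycleFiber c u s t)) =
        ∑ t, (cycleA i t : ℂ) * u t := by
  have hq (t) : c t * cycleFiber c u s t = (u t + paritySign t * s) / ∑ t, u t := by
    rw [cycleFiber, mul_div_assoc', mul_div_mul_left _ _ (hc t)]
  have hsum : ∑ t, paritySign t = 0 := by
    norm_num [paritySign, Fintype.sum_prod_type]
  have hA (i) : ∑ t, (cycleA i t : ℂ) * paritySign t = 0 := by
    fin_cases i <;> norm_num [cycleA, paritySign, Fintype.sum_prod_type]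
  refine ⟨?_, fun i ↦ ?_⟩
  · simp_rw [hq]
    rw [← Finset.sum_div, Finset.sum_add_distrib, ← Finset.sum_mul, hsum, zero_mul, add_zero,
      div_self hu]
  · simp_rw [hq, mul_div_assoc']
    rw [← Finset.sum_div, mul_div_cancel₀ _ hu]
    simp_rw [mul_add, ← mul_assoc]
    rw [Finset.sum_add_distrib, ← Finset.sum_mul, hA, zero_mul, add_zero]

theorem eq_cycleFiber_of_margins {c u p : Fin 2 × Fin 2 × Fin 2 → ℂ} (hc : ∀ t, c t ≠ 0)
    (hu : ∑ t, u t ≠ 0) (h1 : ∑ t, c t * p t = 1)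
    (hA : ∀ i, (∑ t, u t) * (∑ t, (cycleA i t : ℂ) * (c t * p t)) =
      ∑ t, (cycleA i t : ℂ) * u t) :
    p = cycleFiber c u ((∑ t, u t) * (c (0, 0, 0) * p (0, 0, 0)) - u (0, 0, 0)) := by
  have key (t) : u t + paritySign t * ((∑ t, u t) * (c (0, 0, 0) * p (0, 0, 0)) - u (0, 0, 0)) =
      (∑ t, u t) * (c t * p t) := by
    have h0 : (∑ t, u t) * (∑ t, c t * p t) = ∑ t, u t := by rw [h1, mul_one]
    clear h1
    generalize hS : ∑ t, u t = S at hA h0 ⊢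
    rw [← hS] at h0
    nth_rw 1 [hS] at h0
    simp only [Fin.forall_fin_succ, cycleA, Fintype.sum_prod_type] at hA
    simp [Fin.sum_univ_succ] at hA
    simp only [Fintype.sum_prod_type, Fin.sum_univ_two] at h0
    obtain ⟨e1, e2, e3, e4, e5, e6⟩ := hA
    obtain ⟨i, j, k⟩ := t
    fin_cases i <;> fin_cases j <;> fin_cases k <;> norm_num [paritySign]
    · linear_combination e1 + e2 - h0 - e4
    · linear_combination e1 + e3 - h0 - e5
    · linear_combination h0 + e4 + e5 - e1 - e2 - e3
    · linear_combination e2 + e3 - h0 - e6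
    · linear_combination h0 + e4 + e6 - e1 - e2 - e3
    · linear_combination h0 + e5 + e6 - e1 - e2 - e3
    · linear_combination e1 + e2 + e3 - h0 - e4 - e5 - e6
  funext t
  rw [cycleFiber, key, eq_div_iff (mul_ne_zero (hc t) hu)]
  ring

/-- The solutions of the likelihood system correspond to the roots of `cyclePoly`, as soon as no
root leaves the torus. -/
theorem mlSolutions_cycleA_eq_image {c u : Fin 2 × Fin 2 × Fin 2 → ℂ} (hc : ∀ t, c t ≠ 0)
    (hu : ∑ t, u t ≠ 0)
    (h0 : cyclePoly (c (0, 0, 1) * c (0, 1, 0) * c (1, 0, 0) * c (1, 1, 1))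
      (c (0, 0, 0) * c (0, 1, 1) * c (1, 0, 1) * c (1, 1, 0)) u ≠ 0)
    (hpair : ∀ t t', paritySign t = 1 → paritySign t' = -1 → u t + u t' ≠ 0) :
    mlSolutions cycleA c u = cycleFiber c u ''
      (cyclePoly (c (0, 0, 1) * c (0, 1, 0) * c (1, 0, 0) * c (1, 1, 1))
        (c (0, 0, 0) * c (0, 1, 1) * c (1, 0, 1) * c (1, 1, 0)) u).rootSet ℂ := by
  have hbinom (s : ℂ) : (cycleFiber c u s (0, 0, 0) * cycleFiber c u s (0, 1, 1) *
        cycleFiber c u s (1, 0, 1) * cycleFiber c u s (1, 1, 0) =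
      cycleFiber c u s (0, 0, 1) * cycleFiber c u s (0, 1, 0) *
        cycleFiber c u s (1, 0, 0) * cycleFiber c u s (1, 1, 1)) ↔
      c (0, 0, 1) * c (0, 1, 0) * c (1, 0, 0) * c (1, 1, 1) *
          ((s + u (0, 0, 0)) * (s + u (0, 1, 1)) * (s + u (1, 0, 1)) * (s + u (1, 1, 0))) =
        c (0, 0, 0) * c (0, 1, 1) * c (1, 0, 1) * c (1, 1, 0) *
          ((u (0, 0, 1) - s) * (u (0, 1, 0) - s) * (u (1, 0, 0) - s) * (u (1, 1, 1) - s)) := by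
    simp only [cycleFiber, div_mul_div_comm]
    rw [div_eq_div_iff (by simp [hc, hu]) (by simp [hc, hu])]
    generalize ∑ t, u t = S at hu
    norm_num [paritySign]
    refine ⟨fun h ↦ mul_right_cancel₀ (pow_ne_zero 4 hu) ?_, fun h ↦ ?_⟩
    · linear_combination h
    · linear_combination S ^ 4 * h
  ext p
  rw [mem_mlSolutions_cycleA_iff, Set.mem_image]
  simp only [Polynomial.mem_rootSet, Polynomial.aeval_def, Polynomial.eval₂_id,
    Algebra.algebraMap_self, cyclePoly, Polynomial.eval_sub, Polynomial.eval_mul,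
    Polynomial.eval_add, Polynomial.eval_C, Polynomial.eval_X, sub_eq_zero]
  constructor
  · rintro ⟨-, hp, h1, hA⟩
    have hfib := eq_cycleFiber_of_margins hc hu h1 hA
    rw [hfib] at hp
    exact ⟨_, ⟨h0, (hbinom _).mp hp⟩, hfib.symm⟩
  · rintro ⟨s, ⟨-, hs⟩, rfl⟩
    refine ⟨?_, (hbinom s).mpr hs, cycleFiber_margins hc hu s⟩
    intro t ht
    rw [cycleFiber, div_eq_zero_iff, or_iff_left (mul_ne_zero (hc t) hu)] at ht
    have hodd (hε : paritySign t = 1) (t') (hε' : paritySign t' = -1) : u t' - s ≠ 0 := fun h ↦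
      hpair t t' hε hε' (by rw [hε] at ht; linear_combination h + ht)
    have heven (hε : paritySign t = -1) (t') (hε' : paritySign t' = 1) : s + u t' ≠ 0 := fun h ↦
      hpair t' t hε' hε (by rw [hε] at ht; linear_combination h + ht)
    clear hpair
    obtain ⟨i, j, k⟩ := t
    fin_cases i <;> fin_cases j <;> fin_cases k <;>
      norm_num [paritySign] at ht hodd heven <;>
      simp_all [add_comm s, ← sub_eq_add_neg]

/-- The ML degree of the scaled binary 3-cycle is `4` unless the scaling `c` lies on
the principal `A`-determinant `c₀₀₀c₀₁₁c₁₀₁c₁₁₀ - c₀₀₁c₀₁₀c₁₀₀c₁₁₁`, in which case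
it is `3`. -/
theorem ml_degree_binary_three_cycle (c : Fin 2 × Fin 2 × Fin 2 → ℂ)
    (hc : ∀ t, c t ≠ 0) :
    ∃ G : MvPolynomial (Fin 2 × Fin 2 × Fin 2) ℂ, G ≠ 0 ∧
      ∀ u : Fin 2 × Fin 2 × Fin 2 → ℂ, MvPolynomial.eval u G ≠ 0 →
        (mlSolutions cycleA c u).Finite ∧
        (c (0, 0, 0) * c (0, 1, 1) * c (1, 0, 1) * c (1, 1, 0) -
              c (0, 0, 1) * c (0, 1, 0) * c (1, 0, 0) * c (1, 1, 1) ≠ 0 →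
            (mlSolutions cycleA c u).ncard = 4) ∧
        (c (0, 0, 0) * c (0, 1, 1) * c (1, 0, 1) * c (1, 1, 0) -
              c (0, 0, 1) * c (0, 1, 0) * c (1, 0, 0) * c (1, 1, 1) = 0 →
            (mlSolutions cycleA c u).ncard = 3) := by
  obtain ⟨G, hG, hroots⟩ := exists_generic_card_rootSet_cyclePoly
    (a := c (0, 0, 1) * c (0, 1, 0) * c (1, 0, 0) * c (1, 1, 1))
    (b := c (0, 0, 0) * c (0, 1, 1) * c (1, 0, 1) * c (1, 1, 0)) (by simp [hc]) (by simp [hc])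
  refine ⟨G * (∑ t, MvPolynomial.X t) *
    ∏ t, ∏ t', (MvPolynomial.X t + MvPolynomial.X t'), ?_, fun u hu ↦ ?_⟩
  · have hpos : ∀ f : MvPolynomial (Fin 2 × Fin 2 × Fin 2) ℂ,
        MvPolynomial.eval (fun _ ↦ 1) f ≠ 0 → f ≠ 0 := by
      rintro _ h rfl
      exact h (map_zero _)
    refine mul_ne_zero (mul_ne_zero hG (hpos _ (by simp))) ?_
    refine Finset.prod_ne_zero_iff.mpr fun t _ ↦ Finset.prod_ne_zero_iff.mpr fun t' _ ↦ hpos _ ?_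
    norm_num
  · simp only [map_mul, map_sum, map_prod, map_add, MvPolynomial.eval_X] at hu
    obtain ⟨⟨hu1, hu2⟩, hu3⟩ := by simpa only [mul_ne_zero_iff] using hu
    obtain ⟨h0, h4, h3⟩ := hroots u hu1
    have heq := mlSolutions_cycleA_eq_image hc hu2 h0 fun t t' _ _ ↦
      Finset.prod_ne_zero_iff.mp (Finset.prod_ne_zero_iff.mp hu3 t (Finset.mem_univ _)) t'
        (Finset.mem_univ _)
    rw [heq, Set.ncard_image_of_injective _ (cycleFiber_injective hc hu2)]
    refine ⟨(Polynomial.rootSet_finite _ _).image _, fun h ↦ h4 fun h' ↦ h ?_, fun h ↦ h3 ?_⟩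
    · rw [h', sub_self]
    · exact (sub_eq_zero.mp h).symm
end

section
/- Let m ≥ 2 and let A be the matrix of the no-three-way interaction model C_m with one m-ary and two binary variables, as described in the context. Then there exists a nonzero polynomial H ∈ ℂ[c,u] (in the 4m scaling variables and the 4m data variables) such that for every (c,u) ∈ (ℂ*)^{4m} × ℂ^{4m} with H(c,u) ≠ 0 the likelihood system for (A,c,u) has exactly m·2^{m−1} solutions. (The degree of the toric variety C_m equals m·2^{m−1}, and it is attained as the ML degree for generic scalings.) -/
open scoped BigOperators

/-- The matrix of the no-three-way interaction model `C_m` with one `m`-ary and two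
binary variables: columns are indexed by triples `(i,j,k)`, rows by the pairs `(i,j)`,
`(i,k)` and `(j,k)`, and the column of `(i,j,k)` is the indicator vector of its three
pairs, corresponding to `p_{ijk} = a_{ij} b_{ik} c_{jk}`. -/
def c3A (m : ℕ) :
    ((Fin m × Fin 2) ⊕ (Fin m × Fin 2) ⊕ (Fin 2 × Fin 2)) →
      (Fin m × Fin 2 × Fin 2) → ℤ
  | Sum.inl (i, j) => fun t => if i = t.1 ∧ j = t.2.1 then 1 else 0
  | Sum.inr (Sum.inl (i, k)) => fun t => if i = t.1 ∧ k = t.2.2 then 1 else 0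
  | Sum.inr (Sum.inr (j, k)) => fun t => if j = t.2.1 ∧ k = t.2.2 then 1 else 0


open Polynomial Matrix

section RootSum

variable {ι R : Type*} [Fintype ι] [CommRing R]

/-- The Kronecker product of a family of `2 × 2` matrices. -/
def kron (A : ι → Matrix (Fin 2) (Fin 2) R) : Matrix (ι → Fin 2) (ι → Fin 2) R :=
  Matrix.of fun x y => ∏ i, A i (x i) (y i)

lemma kron_one : kron (fun _ : ι => (1 : Matrix (Fin 2) (Fin 2) R)) = 1 := by
  ext x y
  simp only [kron, Matrix.of_apply, Matrix.one_apply, funext_iff]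
  by_cases h : ∀ i, x i = y i
  · simp [h]
  · rw [if_neg h]
    obtain ⟨i, hi⟩ := not_forall.mp h
    exact Finset.prod_eq_zero (Finset.mem_univ i) (if_neg hi)

variable [DecidableEq ι]

lemma kron_mul (A B : ι → Matrix (Fin 2) (Fin 2) R) :
    kron A * kron B = kron fun i => A i * B i := by
  ext x y
  simp only [kron, Matrix.mul_apply, Matrix.of_apply, ← Finset.prod_mul_distrib]
  rw [Fintype.prod_sum]

lemma kron_mulVec (A : ι → Matrix (Fin 2) (Fin 2) R) (w : ι → Fin 2 → R) (x : ι → Fin 2) :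
    (kron A *ᵥ fun y => ∏ i, w i (y i)) x = ∏ i, (A i *ᵥ w i) (x i) := by
  simp only [kron, Matrix.mulVec, dotProduct, Matrix.of_apply, ← Finset.prod_mul_distrib]
  rw [Fintype.prod_sum]

lemma isUnit_det_kron (A : ι → Matrix (Fin 2) (Fin 2) R) (hA : ∀ i, IsUnit (A i).det) :
    IsUnit (kron A).det := by
  rw [← Matrix.isUnit_iff_isUnit_det]
  refine IsUnit.of_mul_eq_one (kron fun i => (A i)⁻¹) ?_
  rw [kron_mul, ← kron_one]
  congr 1
  funext i
  exact Matrix.mul_nonsing_inv _ (hA i)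

/-- For quadratics `α i * s ^ 2 + β i * s + δ i`, the Kronecker sum of their companion matrices,
cleared of the denominators `α i`: its determinant is, up to a product of the `α i`, the product
of all sums obtained by adding up one root of each quadratic. -/
def rootSumMatrix (α β δ : ι → R) : Matrix (ι → Fin 2) (ι → Fin 2) R :=
  ∑ i, kron (Function.update (fun j => !![1, 0; 0, α j]) i !![0, 1; -δ i, -β i])

lemma rootSumMatrix_map {S : Type*} [CommRing S] (f : R →+* S) (α β δ : ι → R) :
    (rootSumMatrix α β δ).map f = rootSumMatrix (f ∘ α) (f ∘ β) (f ∘ δ) := by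
  ext x y
  simp only [rootSumMatrix, Matrix.map_apply, Matrix.sum_apply, kron, Matrix.of_apply, map_sum,
    map_prod]
  refine Finset.sum_congr rfl fun i _ => Finset.prod_congr rfl fun j _ => ?_
  by_cases h : j = i
  · subst h
    generalize x j = a; generalize y j = b
    fin_cases a <;> fin_cases b <;> simp
  · simp only [Function.update_of_ne h]
    generalize x j = a; generalize y j = b
    fin_cases a <;> fin_cases b <;> simp

lemma rootSumMatrix_mulVec (α β δ s : ι → R) (hs : ∀ i, α i * s i ^ 2 + β i * s i + δ i = 0)
    (x : ι → Fin 2) :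
    (rootSumMatrix α β δ *ᵥ fun y => ∏ i, s i ^ (y i : ℕ)) x =
      (∏ i, α i ^ (x i : ℕ)) * ((∏ i, s i ^ (x i : ℕ)) * ∑ i, s i) := by
  rw [rootSumMatrix, Matrix.sum_mulVec, Finset.sum_apply]
  simp only [kron_mulVec _ (fun i (b : Fin 2) => s i ^ (b : ℕ))]
  rw [← mul_assoc, Finset.mul_sum]
  refine Finset.sum_congr rfl fun i _ => ?_
  rw [← Finset.mul_prod_erase _ _ (Finset.mem_univ i), ← Finset.prod_mul_distrib,
    ← Finset.mul_prod_erase _ _ (Finset.mem_univ i), mul_right_comm]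
  congr 1
  · rw [Function.update_self]
    have h := hs i
    generalize x i = a
    fin_cases a
    · simp [Matrix.mulVec, dotProduct]
    · simp [Matrix.mulVec, dotProduct]
      linear_combination -h
  · refine Finset.prod_congr rfl fun j hj => ?_
    rw [Function.update_of_ne (Finset.ne_of_mem_erase hj)]
    generalize x j = a
    fin_cases a <;> simp [Matrix.mulVec, dotProduct]

/-- The matrix whose columns are the vectors `rootSumMatrix_mulVec` acts on, one for each choice
of a root `r i (ε i)` of every quadratic. -/
def rootVectors (r : ι → Fin 2 → R) : Matrix (ι → Fin 2) (ι → Fin 2) R :=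
  kron fun i => Matrix.of fun a b => r i b ^ (a : ℕ)

lemma rootSumMatrix_mul_rootVectors (α β δ : ι → R) (r : ι → Fin 2 → R)
    (hr : ∀ i b, α i * r i b ^ 2 + β i * r i b + δ i = 0) (x ε : ι → Fin 2) :
    (rootSumMatrix α β δ * rootVectors r) x ε =
      (∏ i, α i ^ (x i : ℕ)) * (rootVectors r x ε * ∑ i, r i (ε i)) :=
  rootSumMatrix_mulVec α β δ (fun i => r i (ε i)) (fun i => hr i (ε i)) x

lemma isUnit_det_rootVectors {K : Type*} [Field K] (r : ι → Fin 2 → K)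
    (hr : ∀ i, r i 0 ≠ r i 1) : IsUnit (rootVectors r).det := by
  refine isUnit_det_kron _ fun i => ?_
  rw [Matrix.det_fin_two, isUnit_iff_ne_zero]
  simpa [sub_eq_zero] using (hr i).symm

lemma det_rootSumMatrix {K : Type*} [Field K] (α β δ : ι → K) (r : ι → Fin 2 → K)
    (hr : ∀ i b, α i * r i b ^ 2 + β i * r i b + δ i = 0) (hne : ∀ i, r i 0 ≠ r i 1) :
    (rootSumMatrix α β δ).det =
      (∏ x : ι → Fin 2, ∏ i, α i ^ (x i : ℕ)) * ∏ ε : ι → Fin 2, ∑ i, r i (ε i) := by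
  have h : rootSumMatrix α β δ * rootVectors r =
      Matrix.diagonal (fun x : ι → Fin 2 => ∏ i, α i ^ (x i : ℕ)) *
        (rootVectors r * Matrix.diagonal fun ε => ∑ i, r i (ε i)) := by
    ext x ε
    rw [rootSumMatrix_mul_rootVectors α β δ r hr, Matrix.diagonal_mul, Matrix.mul_diagonal]
  apply_fun Matrix.det at h
  simp only [Matrix.det_mul, Matrix.det_diagonal] at h
  refine mul_right_cancel₀ (isUnit_det_rootVectors r hne).ne_zero (h.trans ?_)
  ring

lemma natDegree_det_le {n : Type*} [Fintype n] [DecidableEq n] (M : Matrix n n R[X]) (d : n → ℕ)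
    (h : ∀ x y, (M x y).natDegree ≤ d x) : M.det.natDegree ≤ ∑ x, d x := by
  rw [← Matrix.det_transpose, Matrix.det_apply]
  refine natDegree_sum_le_of_forall_le _ _ fun σ _ => (natDegree_smul_le _ _).trans ?_
  exact (natDegree_prod_le _ _).trans (Finset.sum_le_sum fun x _ => h _ _)

lemma natDegree_det_rootSumMatrix_le (α β δ : ι → R[X]) (hα : ∀ i, (α i).natDegree ≤ 1)
    (hβ : ∀ i, (β i).natDegree ≤ 1) (hδ : ∀ i, (δ i).natDegree ≤ 1) :
    (rootSumMatrix α β δ).det.natDegree ≤ ∑ x : ι → Fin 2, ∑ i, (x i : ℕ) := by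
  refine natDegree_det_le _ _ fun x y => ?_
  simp only [rootSumMatrix, Matrix.sum_apply, kron, Matrix.of_apply]
  refine natDegree_sum_le_of_forall_le _ _ fun i _ => (natDegree_prod_le _ _).trans
    (Finset.sum_le_sum fun j _ => ?_)
  by_cases h : j = i
  · subst h
    generalize x j = a; generalize y j = b
    fin_cases a <;> fin_cases b <;> simp [hβ, hδ]
  · simp only [Function.update_of_ne h]
    generalize x j = a; generalize y j = b
    fin_cases a <;> fin_cases b <;> simp [hα]

lemma sq_dvd_det_of_isRoot {n : Type*} [Fintype n] [DecidableEq n] {K : Type*} [Field K]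
    (M : Matrix n n K[X]) (θ : K) {a b : n} (hab : a ≠ b) (ha : ∀ x, (M x a).IsRoot θ)
    (hb : ∀ x, (M x b).IsRoot θ) : (X - C θ) ^ 2 ∣ M.det := by
  have h : ∀ x y, ∃ q, M x y = (if y = a ∨ y = b then X - C θ else 1) * q := by
    intro x y
    split_ifs with hy
    · rcases hy with rfl | rfl
      exacts [dvd_iff_isRoot.mpr (ha x), dvd_iff_isRoot.mpr (hb x)]
    · exact ⟨M x y, (one_mul _).symm⟩
  choose q hq using h
  have hM : M = Matrix.of fun x y =>
      (fun y => if y = a ∨ y = b then X - C θ else 1) y * Matrix.of q x y := by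
    ext1 x y
    exact hq x y
  rw [hM, Matrix.det_mul_row]
  refine Dvd.dvd.mul_right ?_ _
  rw [Finset.prod_ite, Finset.prod_const, Finset.prod_const_one, mul_one]
  have : Finset.univ.filter (fun y => y = a ∨ y = b) = {a, b} := by ext; simp
  rw [this, Finset.card_pair hab]

lemma sum_sum_fin_two (m : ℕ) : ∑ x : Fin m → Fin 2, ∑ i, (x i : ℕ) = m * 2 ^ (m - 1) := by
  rw [Finset.sum_comm]
  have h : ∀ i : Fin m, ∑ x : Fin m → Fin 2, (x i : ℕ) = 2 ^ (m - 1) := by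
    intro i
    obtain ⟨k, rfl⟩ : ∃ k, m = k + 1 := ⟨m - 1, by have := i.2; omega⟩
    rw [← (Fin.insertNthEquiv (fun _ => Fin 2) i).sum_comp, Fintype.sum_prod_type]
    simp
  simp [h]

end RootSum

section LikelihoodPolynomial

variable {m : ℕ} {R S : Type*} [CommRing R] [CommRing S]

/-- The leading coefficient, in `s`, of the quadratic
`c₀₁ c₁₀ (u₀₀ + s) (u₁₁ + s) - X c₀₀ c₁₁ (u₀₁ - s) (u₁₀ - s)` attached to the `i`-th slice. -/
noncomputable def sliceLead (c : Fin m × Fin 2 × Fin 2 → R) (i : Fin m) : R[X] :=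
  C (c (i, 0, 1) * c (i, 1, 0)) - X * C (c (i, 0, 0) * c (i, 1, 1))

/-- The linear coefficient of the quadratic of the `i`-th slice. -/
noncomputable def sliceMid (c u : Fin m × Fin 2 × Fin 2 → R) (i : Fin m) : R[X] :=
  C (c (i, 0, 1) * c (i, 1, 0) * (u (i, 0, 0) + u (i, 1, 1))) +
    X * C (c (i, 0, 0) * c (i, 1, 1) * (u (i, 0, 1) + u (i, 1, 0)))

/-- The constant coefficient of the quadratic of the `i`-th slice. -/
noncomputable def sliceConst (c u : Fin m × Fin 2 × Fin 2 → R) (i : Fin m) : R[X] :=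
  C (c (i, 0, 1) * c (i, 1, 0) * (u (i, 0, 0) * u (i, 1, 1))) -
    X * C (c (i, 0, 0) * c (i, 1, 1) * (u (i, 0, 1) * u (i, 1, 0)))

/-- The polynomial whose roots are the (scaled) odds ratios of the critical points. -/
noncomputable def oddsPoly (c u : Fin m × Fin 2 × Fin 2 → R) : R[X] :=
  (rootSumMatrix (sliceLead c) (sliceMid c u) (sliceConst c u)).det

/-- A polynomial vanishing at all odds ratios at which the elimination degenerates. -/
noncomputable def degeneracyPoly (c u : Fin m × Fin 2 × Fin 2 → R) : R[X] :=
  X * (∏ i, sliceLead c i) * (∏ i, discrim (sliceLead c i) (sliceMid c u i) (sliceConst c u i)) *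
    derivative (oddsPoly c u)

lemma sliceLead_map (f : R →+* S) (c : Fin m × Fin 2 × Fin 2 → R) (i : Fin m) :
    (sliceLead c i).map f = sliceLead (f ∘ c) i := by
  simp [sliceLead]

lemma sliceMid_map (f : R →+* S) (c u : Fin m × Fin 2 × Fin 2 → R) (i : Fin m) :
    (sliceMid c u i).map f = sliceMid (f ∘ c) (f ∘ u) i := by
  simp [sliceMid]

lemma sliceConst_map (f : R →+* S) (c u : Fin m × Fin 2 × Fin 2 → R) (i : Fin m) :
    (sliceConst c u i).map f = sliceConst (f ∘ c) (f ∘ u) i := by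
  simp [sliceConst]

lemma oddsPoly_map (f : R →+* S) (c u : Fin m × Fin 2 × Fin 2 → R) :
    (oddsPoly c u).map f = oddsPoly (f ∘ c) (f ∘ u) := by
  rw [oddsPoly, ← coe_mapRingHom, RingHom.map_det, RingHom.mapMatrix_apply, rootSumMatrix_map,
    oddsPoly]
  congr 2 <;> funext i
  · exact sliceLead_map f c i
  · exact sliceMid_map f c u i
  · exact sliceConst_map f c u i

lemma degeneracyPoly_map (f : R →+* S) (c u : Fin m × Fin 2 × Fin 2 → R) :
    (degeneracyPoly c u).map f = degeneracyPoly (f ∘ c) (f ∘ u) := by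
  simp only [degeneracyPoly, discrim, Polynomial.map_mul, Polynomial.map_prod, map_X,
    Polynomial.map_sub, Polynomial.map_pow, ← derivative_map, oddsPoly_map, sliceLead_map,
    sliceMid_map, sliceConst_map, Polynomial.map_ofNat]

lemma natDegree_oddsPoly_le (c u : Fin m × Fin 2 × Fin 2 → R) :
    (oddsPoly c u).natDegree ≤ m * 2 ^ (m - 1) := by
  rw [← sum_sum_fin_two]
  refine natDegree_det_rootSumMatrix_le _ _ _ (fun i => ?_) (fun i => ?_) (fun i => ?_)
  · rw [sliceLead]; compute_degree
  · rw [sliceMid]; compute_degree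
  · rw [sliceConst]; compute_degree

lemma eval_oddsPoly (c u : Fin m × Fin 2 × Fin 2 → R) (θ : R) :
    (oddsPoly c u).eval θ = (rootSumMatrix (fun i => (sliceLead c i).eval θ)
      (fun i => (sliceMid c u i).eval θ) (fun i => (sliceConst c u i).eval θ)).det := by
  rw [oddsPoly, ← coe_evalRingHom, RingHom.map_det, RingHom.mapMatrix_apply, rootSumMatrix_map]
  rfl

lemma slice_quadratic (c u : Fin m × Fin 2 × Fin 2 → R) (θ s : R) (i : Fin m) :
    (sliceLead c i).eval θ * s ^ 2 + (sliceMid c u i).eval θ * s + (sliceConst c u i).eval θ =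
      c (i, 0, 1) * c (i, 1, 0) * ((u (i, 0, 0) + s) * (u (i, 1, 1) + s)) -
        θ * (c (i, 0, 0) * c (i, 1, 1) * ((u (i, 0, 1) - s) * (u (i, 1, 0) - s))) := by
  simp only [sliceLead, sliceMid, sliceConst, eval_sub, eval_add, eval_mul, eval_X, eval_C]
  ring

end LikelihoodPolynomial

section Roots

variable {m : ℕ}

lemma eval_discrim {R : Type*} [CommRing R] (a b c : R[X]) (θ : R) :
    (discrim a b c).eval θ = discrim (a.eval θ) (b.eval θ) (c.eval θ) := by
  simp [discrim]

lemma exists_two_roots {a b c : ℂ} (ha : a ≠ 0) (hd : discrim a b c ≠ 0) :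
    ∃ r : Fin 2 → ℂ, r 0 ≠ r 1 ∧ (∀ j, a * r j ^ 2 + b * r j + c = 0) ∧
      ∀ s, a * s ^ 2 + b * s + c = 0 → ∃ j, s = r j := by
  obtain ⟨w, hw⟩ := IsAlgClosed.exists_eq_mul_self (discrim a b c)
  have h := fun s => quadratic_eq_zero_iff ha hw s
  have hw0 : w ≠ 0 := by
    rintro rfl
    simp [hw] at hd
  refine ⟨![(-b + w) / (2 * a), (-b - w) / (2 * a)], ?_, fun j => ?_, fun s hs => ?_⟩
  · intro he
    have : (-b + w) = (-b - w) := by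
      simpa [div_left_inj' (mul_ne_zero two_ne_zero ha)] using he
    exact hw0 (by linear_combination this / 2)
  · have := (h (![(-b + w) / (2 * a), (-b - w) / (2 * a)] j)).mpr (by fin_cases j <;> simp)
    linear_combination this
  · rcases (h s).mp (by linear_combination hs) with h | h
    exacts [⟨0, h⟩, ⟨1, h⟩]

/-- At a nondegenerate root of `oddsPoly` exactly one choice of roots of the slice quadratics
sums to zero. -/
lemma existsUnique_of_isRoot (c u : Fin m × Fin 2 × Fin 2 → ℂ) {θ : ℂ}
    (hθ : (oddsPoly c u).IsRoot θ) (hdeg : (degeneracyPoly c u).eval θ ≠ 0) :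
    ∃! s : Fin m → ℂ, ∑ i, s i = 0 ∧ ∀ i, (sliceLead c i).eval θ * s i ^ 2 +
      (sliceMid c u i).eval θ * s i + (sliceConst c u i).eval θ = 0 := by
  simp only [degeneracyPoly, eval_mul, eval_prod, eval_discrim, mul_ne_zero_iff,
    Finset.prod_ne_zero_iff, Finset.mem_univ, true_implies] at hdeg
  obtain ⟨⟨⟨-, hlead⟩, hdisc⟩, hder⟩ := hdeg
  choose r hne hr hcomplete using fun i => exists_two_roots (hlead i) (hdisc i)
  have heval := eval_oddsPoly c u θ
  rw [hθ, det_rootSumMatrix _ _ _ r hr hne] at heval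
  obtain ⟨ε, -, hε⟩ := Finset.prod_eq_zero_iff.mp ((mul_eq_zero.mp heval.symm).resolve_left
    (Finset.prod_ne_zero_iff.mpr fun x _ => Finset.prod_ne_zero_iff.mpr fun i _ =>
      pow_ne_zero _ (hlead i)))
  refine ⟨fun i => r i (ε i), ⟨hε, fun i => hr i _⟩, ?_⟩
  rintro s ⟨hs, hq⟩
  choose ε' hε' using fun i => hcomplete i (s i) (hq i)
  obtain rfl : s = fun i => r i (ε' i) := funext hε'
  by_contra hcon
  have hεε' : ε ≠ ε' := by
    rintro rfl
    exact hcon rfl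
  let M := rootSumMatrix (sliceLead c) (sliceMid c u) (sliceConst c u)
  have hcol : ∀ e : Fin m → Fin 2, ∑ i, r i (e i) = 0 → ∀ x,
      ((M * (rootVectors r).map C) x e).IsRoot θ := by
    intro e he x
    have h := rootSumMatrix_mul_rootVectors (fun i => (sliceLead c i).eval θ)
      (fun i => (sliceMid c u i).eval θ) (fun i => (sliceConst c u i).eval θ) r hr x e
    rw [he, mul_zero, mul_zero] at h
    rw [IsRoot.def, ← h]
    have hM : rootSumMatrix (fun i => (sliceLead c i).eval θ)
      (fun i => (sliceMid c u i).eval θ) (fun i => (sliceConst c u i).eval θ) =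
        M.map (evalRingHom θ) := (rootSumMatrix_map (evalRingHom θ) _ _ _).symm
    rw [hM]
    simp [Matrix.mul_apply, eval_finsetSum]
  obtain ⟨g, hg⟩ := sq_dvd_det_of_isRoot _ θ hεε' (hcol ε hε) (hcol ε' hs)
  have hV : ((rootVectors r).map C).det = C (rootVectors r).det := (RingHom.map_det C _).symm
  rw [Matrix.det_mul, hV] at hg
  have hg' := congrArg (fun p => (derivative p).eval θ) hg
  simp only [derivative_mul, derivative_C, mul_zero, add_zero, eval_mul, eval_C, eval_add,
    derivative_pow, eval_pow, eval_sub, eval_X, sub_self] at hg'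
  have : (derivative M.det).eval θ * (rootVectors r).det = 0 := by
    simpa using hg'
  exact (mul_ne_zero hder (isUnit_det_rootVectors r hne).ne_zero) this

end Roots

section CriticalPoints

variable {m : ℕ}

/-- The sign with which the slice parameter enters the cell `(j, k)`. -/
def cellSign {R : Type*} [Ring R] (jk : Fin 2 × Fin 2) : R := if jk.1 = jk.2 then 1 else -1

/-- The candidate critical point with slice parameters `s`. -/
noncomputable def slicePoint (c u : Fin m × Fin 2 × Fin 2 → ℂ) (s : Fin m → ℂ) :
    Fin m × Fin 2 × Fin 2 → ℂ :=
  fun t => (u t + cellSign t.2 * s t.1) / ((∑ t, u t) * c t)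

lemma sum_cells {R : Type*} [AddCommMonoid R] (f : Fin m × Fin 2 × Fin 2 → R) :
    ∑ t, f t = ∑ i, (f (i, 0, 0) + f (i, 0, 1) + (f (i, 1, 0) + f (i, 1, 1))) := by
  simp [Fintype.sum_prod_type, Fin.sum_univ_two]

lemma sum_row_slice_left {R : Type*} [Ring R] (f : Fin m × Fin 2 × Fin 2 → R) (i : Fin m)
    (j : Fin 2) : ∑ t, (c3A m (Sum.inl (i, j)) t : R) * f t = f (i, j, 0) + f (i, j, 1) := by
  rw [sum_cells, Finset.sum_eq_single i]
  · fin_cases j <;> simp [c3A]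
  · intro b _ hb
    simp [c3A, hb.symm]
  · simp

lemma sum_row_slice_right {R : Type*} [Ring R] (f : Fin m × Fin 2 × Fin 2 → R) (i : Fin m)
    (k : Fin 2) :
    ∑ t, (c3A m (Sum.inr (Sum.inl (i, k))) t : R) * f t = f (i, 0, k) + f (i, 1, k) := by
  rw [sum_cells, Finset.sum_eq_single i]
  · fin_cases k <;> simp [c3A]
  · intro b _ hb
    simp [c3A, hb.symm]
  · simp

lemma sum_row_binary {R : Type*} [Ring R] (f : Fin m × Fin 2 × Fin 2 → R) (j k : Fin 2) :
    ∑ t, (c3A m (Sum.inr (Sum.inr (j, k))) t : R) * f t = ∑ i, f (i, j, k) := by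
  rw [sum_cells]
  refine Finset.sum_congr rfl fun i _ => ?_
  fin_cases j <;> fin_cases k <;> simp [c3A]

/-- All two-way margins of a table vanish iff it is a signed multiple of the `2 × 2` checkerboard
in every slice, with multiples summing to zero. -/
lemma margins_eq_zero_iff {R : Type*} [CommRing R] (d : Fin m × Fin 2 × Fin 2 → R) :
    (∀ r, ∑ t, (c3A m r t : R) * d t = 0) ↔
      ∃ s : Fin m → R, ∑ i, s i = 0 ∧ ∀ t, d t = cellSign t.2 * s t.1 := by
  constructor
  · intro h
    refine ⟨fun i => d (i, 0, 0), ?_, ?_⟩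
    · rw [← sum_row_binary]
      exact h _
    · rintro ⟨i, j, k⟩
      have h1 := (sum_row_slice_left d i 0).symm.trans (h _)
      have h2 := (sum_row_slice_right d i 0).symm.trans (h _)
      have h3 := (sum_row_slice_left d i 1).symm.trans (h _)
      fin_cases j <;> fin_cases k <;> simp [cellSign]
      · linear_combination h1
      · linear_combination h2
      · linear_combination h3 - h2
  · rintro ⟨s, hs, hd⟩ (⟨i, j⟩ | ⟨i, k⟩ | ⟨j, k⟩)
    · rw [sum_row_slice_left, hd, hd]
      fin_cases j <;> simp [cellSign]
    · rw [sum_row_slice_right, hd, hd]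
      fin_cases k <;> simp [cellSign]
    · rw [sum_row_binary]
      simp only [hd, ← Finset.mul_sum, hs, mul_zero]

lemma prod_pow_eq_iff_prod_zpow {ι K : Type*} [Fintype ι] [Field K] (p : ι → K)
    (hp : ∀ j, p j ≠ 0) (v : ι → ℤ) :
    (∏ j, p j ^ (max (v j) 0).toNat = ∏ j, p j ^ (max (-v j) 0).toNat) ↔
      ∏ j, p j ^ v j = 1 := by
  have h : ∏ j, p j ^ v j =
      (∏ j, p j ^ (max (v j) 0).toNat) / ∏ j, p j ^ (max (-v j) 0).toNat := by
    rw [← Finset.prod_div_distrib]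
    refine Finset.prod_congr rfl fun j _ => ?_
    rw [← zpow_natCast, ← zpow_natCast, ← zpow_sub₀ (hp j)]
    congr 1
    omega
  rw [h, div_eq_one_iff_eq (Finset.prod_ne_zero_iff.mpr fun j _ => pow_ne_zero _ (hp j))]

lemma prod_cells_zpow {K : Type*} [Field K] (p : Fin m × Fin 2 × Fin 2 → K) (w : Fin m → ℤ) :
    ∏ t, p t ^ (cellSign t.2 * w t.1) =
      ∏ i, (p (i, 0, 0) * p (i, 1, 1) / (p (i, 0, 1) * p (i, 1, 0))) ^ w i := by
  rw [Fintype.prod_prod_type]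
  refine Finset.prod_congr rfl fun i _ => ?_
  simp [Fintype.prod_prod_type, Fin.prod_univ_two, cellSign, div_zpow, mul_zpow]
  ring

/-- The binomial equations say that all slices have the same odds ratio. -/
lemma binomials_iff {K : Type*} [Field K] (hm : 0 < m) (p : Fin m × Fin 2 × Fin 2 → K)
    (hp : ∀ t, p t ≠ 0) :
    (∀ v : Fin m × Fin 2 × Fin 2 → ℤ, (∀ r, ∑ t, c3A m r t * v t = 0) → ∑ t, v t = 0 →
      ∏ t, p t ^ (max (v t) 0).toNat = ∏ t, p t ^ (max (-v t) 0).toNat) ↔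
    ∃ θ, θ ≠ 0 ∧ ∀ i, p (i, 0, 0) * p (i, 1, 1) / (p (i, 0, 1) * p (i, 1, 0)) = θ := by
  have hodds : ∀ i, p (i, 0, 0) * p (i, 1, 1) / (p (i, 0, 1) * p (i, 1, 0)) ≠ 0 := fun i =>
    div_ne_zero (mul_ne_zero (hp _) (hp _)) (mul_ne_zero (hp _) (hp _))
  constructor
  · intro h
    refine ⟨_, hodds ⟨0, hm⟩, fun i => ?_⟩
    by_cases hi : i = ⟨0, hm⟩
    · rw [hi]
    let w : Fin m → ℤ := Pi.single i 1 - Pi.single ⟨0, hm⟩ 1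
    have hw : ∑ i, w i = 0 := by simp [w]
    have hmargin := (margins_eq_zero_iff fun t : Fin m × Fin 2 × Fin 2 =>
      cellSign t.2 * w t.1).mpr ⟨w, hw, fun _ => rfl⟩
    have htotal : ∑ t : Fin m × Fin 2 × Fin 2, cellSign t.2 * w t.1 = 0 := by
      rw [sum_cells]
      simp [cellSign]
    have := (prod_pow_eq_iff_prod_zpow p hp _).mp (h _ hmargin htotal)
    rw [prod_cells_zpow, Finset.prod_eq_mul i ⟨0, hm⟩ hi] at this
    · simp only [w, Pi.sub_apply, Pi.single_eq_same, Pi.single_eq_of_ne hi,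
        Pi.single_eq_of_ne (Ne.symm hi), sub_zero, zpow_one, zero_sub, _root_.zpow_neg] at this
      exact (mul_inv_eq_one₀ (hodds _)).mp this
    · rintro j - ⟨hj, hj'⟩
      simp [w, hj, hj']
    · simp
    · simp
  · rintro ⟨θ, hθ, h⟩ v hv -
    obtain ⟨w, hw, hvw⟩ := (margins_eq_zero_iff v).mp hv
    rw [prod_pow_eq_iff_prod_zpow p hp]
    simp only [hvw, prod_cells_zpow, h]
    have hsum : ∀ s : Finset (Fin m), ∏ i ∈ s, θ ^ w i = θ ^ ∑ i ∈ s, w i := by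
      intro s
      induction s using Finset.induction_on with
      | empty => simp
      | insert a s ha ih => rw [Finset.prod_insert ha, Finset.sum_insert ha, ih, zpow_add₀ hθ]
    rw [hsum, hw, zpow_zero]

lemma mem_mlSolutions_iff (hm : 0 < m) (c u : Fin m × Fin 2 × Fin 2 → ℂ) (hc : ∀ t, c t ≠ 0)
    (hu : ∑ t, u t ≠ 0) (p : Fin m × Fin 2 × Fin 2 → ℂ) :
    p ∈ mlSolutions (c3A m) c u ↔ ∃ θ s, θ ≠ 0 ∧ ∑ i, s i = 0 ∧
      (∀ i, (sliceLead c i).eval θ * s i ^ 2 + (sliceMid c u i).eval θ * s i +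
        (sliceConst c u i).eval θ = 0) ∧ (∀ t, u t + cellSign t.2 * s t.1 ≠ 0) ∧
      p = slicePoint c u s := by
  have hlin : ((∑ t, c t * p t = 1) ∧ ∀ r, (∑ t, u t) * (∑ t, (c3A m r t : ℂ) * (c t * p t)) =
      ∑ t, (c3A m r t : ℂ) * u t) ↔ ∃ s, ∑ i, s i = 0 ∧ p = slicePoint c u s := by
    have h1 : (∀ r, (∑ t, u t) * (∑ t, (c3A m r t : ℂ) * (c t * p t)) =
        ∑ t, (c3A m r t : ℂ) * u t) ↔
        ∀ r, ∑ t, (c3A m r t : ℂ) * ((∑ t, u t) * (c t * p t) - u t) = 0 := by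
      refine forall_congr' fun r => ?_
      rw [← sub_eq_zero, Finset.mul_sum, ← Finset.sum_sub_distrib]
      refine iff_of_eq (congrArg (· = 0) (Finset.sum_congr rfl fun t _ => ?_))
      ring
    have h2 : ∀ s, (∀ t, (∑ t, u t) * (c t * p t) - u t = cellSign t.2 * s t.1) ↔
        p = slicePoint c u s := by
      intro s
      rw [funext_iff]
      refine forall_congr' fun t => ?_
      rw [slicePoint, eq_div_iff (mul_ne_zero hu (hc t)), sub_eq_iff_eq_add]
      refine iff_of_eq (congrArg₂ _ ?_ ?_) <;> ring
    rw [h1, margins_eq_zero_iff]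
    simp only [h2]
    refine ⟨fun h => h.2, fun h => ⟨?_, h⟩⟩
    obtain ⟨s, hs, hp⟩ := h
    have h3 := (h2 s).mpr hp
    have h4 : ∑ t, ((∑ t, u t) * (c t * p t) - u t) = 0 := by
      simp only [h3]
      rw [sum_cells]
      simp [cellSign]
    rw [Finset.sum_sub_distrib, ← Finset.mul_sum, sub_eq_zero] at h4
    exact mul_left_cancel₀ hu (h4.trans (mul_one _).symm)
  have hpoint : ∀ s, (∀ t, slicePoint c u s t ≠ 0) ↔ ∀ t, u t + cellSign t.2 * s t.1 ≠ 0 :=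
    fun s => forall_congr' fun t => by simp [slicePoint, hu, hc t]
  have hodds : ∀ s θ i, (∀ t, slicePoint c u s t ≠ 0) →
      (slicePoint c u s (i, 0, 0) * slicePoint c u s (i, 1, 1) /
        (slicePoint c u s (i, 0, 1) * slicePoint c u s (i, 1, 0)) = θ ↔
      (sliceLead c i).eval θ * s i ^ 2 + (sliceMid c u i).eval θ * s i +
        (sliceConst c u i).eval θ = 0) := by
    intro s θ i hp
    rw [slice_quadratic, div_eq_iff (mul_ne_zero (hp _) (hp _)), sub_eq_zero]
    simp only [slicePoint, cellSign]
    have h00 := hc (i, 0, 0)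
    have h01 := hc (i, 0, 1)
    have h10 := hc (i, 1, 0)
    have h11 := hc (i, 1, 1)
    simp only [Fin.isValue, if_true, zero_ne_one, one_ne_zero, if_false, one_mul, neg_one_mul,
      ← sub_eq_add_neg, div_mul_div_comm]
    rw [← mul_div_assoc, div_eq_div_iff (by positivity) (by positivity)]
    have hfac : (∑ t, u t) * (∑ t, u t) ≠ 0 := mul_ne_zero hu hu
    constructor
    · intro h
      refine mul_left_cancel₀ hfac ?_
      linear_combination h
    · intro h
      linear_combination (∑ t, u t) * (∑ t, u t) * h
  rw [mlSolutions, Set.mem_ofPred_eq, hlin]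
  constructor
  · rintro ⟨hp, hbin, s, hs, rfl⟩
    obtain ⟨θ, hθ, h⟩ := (binomials_iff hm _ hp).mp hbin
    exact ⟨θ, s, hθ, hs, fun i => (hodds s θ i hp).mp (h i), (hpoint s).mp hp, rfl⟩
  · rintro ⟨θ, s, hθ, hs, hq, hne, rfl⟩
    have hp := (hpoint s).mpr hne
    exact ⟨hp, (binomials_iff hm _ hp).mpr ⟨θ, hθ, fun i => (hodds s θ i hp).mpr (hq i)⟩,
      s, hs, rfl⟩

/-- Off a product of hyperplanes, no coordinate of a candidate point vanishes. -/
lemma cell_ne_zero_of_quadratic (c u : Fin m × Fin 2 × Fin 2 → ℂ) (hc : ∀ t, c t ≠ 0) {θ : ℂ}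
    (hθ : θ ≠ 0) (s : Fin m → ℂ)
    (hmargin : ∀ i j k, u (i, j, j) + u (i, k, 1 - k) ≠ 0)
    (hq : ∀ i, (sliceLead c i).eval θ * s i ^ 2 + (sliceMid c u i).eval θ * s i +
      (sliceConst c u i).eval θ = 0) (t : Fin m × Fin 2 × Fin 2) :
    u t + cellSign t.2 * s t.1 ≠ 0 := by
  obtain ⟨i, j, k⟩ := t
  have h := hq i
  rw [slice_quadratic] at h
  have h1 := hmargin i 0 0
  have h2 := hmargin i 0 1
  have h3 := hmargin i 1 0
  have h4 := hmargin i 1 1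
  have hl : c (i, 0, 1) * c (i, 1, 0) ≠ 0 := mul_ne_zero (hc _) (hc _)
  have hk : θ * (c (i, 0, 0) * c (i, 1, 1)) ≠ 0 := mul_ne_zero hθ (mul_ne_zero (hc _) (hc _))
  have hcase : ((u (i, 0, 0) + s i) * (u (i, 1, 1) + s i) = 0 ∨
      (u (i, 0, 1) - s i) * (u (i, 1, 0) - s i) = 0) →
      (u (i, 0, 0) + s i) * (u (i, 1, 1) + s i) = 0 ∧
        (u (i, 0, 1) - s i) * (u (i, 1, 0) - s i) = 0 := by
    rintro (h0 | h0)
    · refine ⟨h0, (mul_eq_zero.mp ?_).resolve_left hk⟩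
      linear_combination c (i, 0, 1) * c (i, 1, 0) * h0 - h
    · refine ⟨(mul_eq_zero.mp ?_).resolve_left hl, h0⟩
      linear_combination θ * (c (i, 0, 0) * c (i, 1, 1)) * h0 + h
  have hall : (u (i, 0, 0) + s i) * (u (i, 1, 1) + s i) ≠ 0 ∧
      (u (i, 0, 1) - s i) * (u (i, 1, 0) - s i) ≠ 0 := by
    by_contra hcon
    obtain ⟨ha, hb⟩ := hcase (by tauto)
    rcases mul_eq_zero.mp ha with ha | ha <;> rcases mul_eq_zero.mp hb with hb | hb
    · exact h1 (by simpa using (by linear_combination ha + hb : u (i, 0, 0) + u (i, 0, 1) = 0))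
    · exact h2 (by simpa using (by linear_combination ha + hb : u (i, 0, 0) + u (i, 1, 0) = 0))
    · exact h3 (by simpa using (by linear_combination ha + hb : u (i, 1, 1) + u (i, 0, 1) = 0))
    · exact h4 (by simpa using (by linear_combination ha + hb : u (i, 1, 1) + u (i, 1, 0) = 0))
  obtain ⟨ha, hb⟩ := hall
  rw [mul_ne_zero_iff] at ha hb
  fin_cases j <;> fin_cases k <;> simp [cellSign, ← sub_eq_add_neg, ha, hb]

lemma card_roots_eq_of_coeff_ne_zero {K : Type*} [Field K] [IsAlgClosed K] [DecidableEq K]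
    {f : K[X]} {N : ℕ} (hle : f.natDegree ≤ N) (hN : f.coeff N ≠ 0)
    (hsimple : ∀ x, f.IsRoot x → f.derivative.eval x ≠ 0) : f.roots.toFinset.card = N := by
  have hf : f ≠ 0 := by
    rintro rfl
    simp at hN
  have hdeg : f.natDegree = N := natDegree_eq_of_le_of_coeff_ne_zero hle hN
  rw [Multiset.toFinset_card_of_nodup, IsAlgClosed.card_roots_eq_natDegree, hdeg]
  rw [Multiset.nodup_iff_count_le_one]
  intro x
  rw [count_roots]
  by_contra! h
  obtain ⟨h1, h2⟩ := (one_lt_rootMultiplicity_iff_isRoot hf).mp h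
  exact hsimple x h1 h2

lemma ncard_mlSolutions (hm : 0 < m) (c u : Fin m × Fin 2 × Fin 2 → ℂ) (hc : ∀ t, c t ≠ 0)
    (hu : ∑ t, u t ≠ 0) (hmargin : ∀ i j k, u (i, j, j) + u (i, k, 1 - k) ≠ 0)
    (hcoeff : (oddsPoly c u).coeff (m * 2 ^ (m - 1)) ≠ 0)
    (hdeg : ∀ θ, (oddsPoly c u).IsRoot θ → (degeneracyPoly c u).eval θ ≠ 0) :
    (mlSolutions (c3A m) c u).Finite ∧
      (mlSolutions (c3A m) c u).ncard = m * 2 ^ (m - 1) := by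
  classical
  have hne : oddsPoly c u ≠ 0 := by
    intro h
    simp [h] at hcoeff
  have hcard := card_roots_eq_of_coeff_ne_zero (natDegree_oddsPoly_le c u) hcoeff
    fun θ hθ h0 => hdeg θ hθ (by simp [degeneracyPoly, h0])
  have hmem : ∀ θ, θ ∈ (oddsPoly c u).roots.toFinset ↔ (oddsPoly c u).IsRoot θ := by
    simp [hne]
  have hroot0 : ∀ θ, (oddsPoly c u).IsRoot θ → θ ≠ 0 := by
    rintro θ hθ rfl
    exact hdeg 0 hθ (by simp [degeneracyPoly])
  choose! s hs huniq using fun θ (hθ : (oddsPoly c u).IsRoot θ) =>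
    existsUnique_of_isRoot c u hθ (hdeg θ hθ)
  have himage : mlSolutions (c3A m) c u =
      (fun θ => slicePoint c u (s θ)) '' ((oddsPoly c u).roots.toFinset : Set ℂ) := by
    ext p
    rw [mem_mlSolutions_iff hm c u hc hu]
    constructor
    · rintro ⟨θ, s', hθ, hs', hq, -, rfl⟩
      have hθroot : (oddsPoly c u).IsRoot θ := by
        rw [IsRoot.def, eval_oddsPoly]
        refine Matrix.exists_mulVec_eq_zero_iff.mp
          ⟨fun y => ∏ i, s' i ^ (y i : ℕ), fun h => ?_, ?_⟩
        · simpa using congrFun h 0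
        · funext x
          rw [rootSumMatrix_mulVec _ _ _ s' hq, hs']
          simp
      exact ⟨θ, (hmem θ).mpr hθroot, by simp only [huniq θ hθroot s' ⟨hs', hq⟩]⟩
    · rintro ⟨θ, hθ, rfl⟩
      have hθ := (hmem θ).mp hθ
      exact ⟨θ, s θ, hroot0 θ hθ, (hs θ hθ).1, (hs θ hθ).2,
        cell_ne_zero_of_quadratic c u hc (hroot0 θ hθ) _ hmargin (hs θ hθ).2, rfl⟩
  have hinj : Set.InjOn (fun θ => slicePoint c u (s θ))
      ((oddsPoly c u).roots.toFinset : Set ℂ) := by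
    intro θ hθ θ' hθ' heq
    have hθ := (hmem θ).mp hθ
    have hθ' := (hmem θ').mp hθ'
    let i : Fin m := ⟨0, hm⟩
    have hsi : s θ i = s θ' i := by
      have := congrFun heq (i, 0, 0)
      simpa [slicePoint, cellSign, hu, hc, div_left_inj'] using this
    have h1 := (hs θ hθ).2 i
    have h2 := (hs θ' hθ').2 i
    have hcell := cell_ne_zero_of_quadratic c u hc (hroot0 θ hθ) _ hmargin (hs θ hθ).2
    have h01 := hcell (i, 0, 1)
    have h10 := hcell (i, 1, 0)
    rw [slice_quadratic] at h1 h2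
    rw [← hsi] at h2
    simp only [cellSign, Fin.isValue, zero_ne_one, one_ne_zero, if_false, neg_one_mul,
      ← sub_eq_add_neg] at h01 h10
    refine mul_right_cancel₀ (mul_ne_zero (mul_ne_zero (hc (i, 0, 0)) (hc (i, 1, 1)))
      (mul_ne_zero h01 h10)) ?_
    linear_combination h2 - h1
  rw [himage]
  refine ⟨(Finset.finite_toSet _).image _, ?_⟩
  rw [hinj.ncard_image, Set.ncard_coe_finset, hcard]

end CriticalPoints

section PartialFractions

variable {ι : Type*} (z : ι → ℂ)

/-- The polynomial `∏ (z i - X)` over a set of nodes. -/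
noncomputable def nodeProd (S : Finset ι) : ℂ[X] := ∏ i ∈ S, (C (z i) - X)

lemma eval_nodeProd (S : Finset ι) (θ : ℂ) : (nodeProd z S).eval θ = ∏ i ∈ S, (z i - θ) := by
  simp [nodeProd, eval_prod]

lemma eval_nodeProd_eq_zero {S : Finset ι} {i : ι} (hi : i ∈ S) :
    (nodeProd z S).eval (z i) = 0 := by
  rw [eval_nodeProd]
  exact Finset.prod_eq_zero hi (sub_self _)

variable [DecidableEq ι]

/-- The numerator of `∑ z i / (z i - X)` over a set of nodes. -/
noncomputable def nodeSum (S : Finset ι) : ℂ[X] :=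
  ∑ i ∈ S, C (z i) * ∏ j ∈ S.erase i, (C (z j) - X)

/-- The numerator of `∑ z i / (X - z i) - T` over a set of nodes. -/
noncomputable def levelPoly (T : ℂ) (S : Finset ι) : ℂ[X] :=
  -(nodeSum z S + C T * nodeProd z S)

lemma eval_nodeSum_node {S : Finset ι} {i : ι} (hi : i ∈ S) :
    (nodeSum z S).eval (z i) = z i * ∏ j ∈ S.erase i, (z j - z i) := by
  rw [nodeSum, eval_finsetSum, Finset.sum_eq_single i]
  · simp [eval_prod]
  · intro j hj hji
    rw [eval_mul, eval_prod,
      Finset.prod_eq_zero (Finset.mem_erase.mpr ⟨hji.symm, hi⟩) (by simp), mul_zero]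
  · exact fun h => absurd hi h

lemma eval_derivative_nodeProd_node {S : Finset ι} {i : ι} (hi : i ∈ S) :
    (derivative (nodeProd z S)).eval (z i) = -∏ j ∈ S.erase i, (z j - z i) := by
  rw [nodeProd, ← Finset.mul_prod_erase _ _ hi, derivative_mul]
  simp [eval_prod]

lemma prod_erase_sub_ne_zero (hz : Function.Injective z) (S : Finset ι) (i : ι) :
    ∏ j ∈ S.erase i, (z j - z i) ≠ 0 :=
  Finset.prod_ne_zero_iff.mpr fun _ hj => sub_ne_zero.mpr (hz.ne (Finset.ne_of_mem_erase hj))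

lemma eval_nodeSum (S : Finset ι) {θ : ℂ} (hθ : ∀ i ∈ S, θ ≠ z i) :
    (nodeSum z S).eval θ = (∏ i ∈ S, (z i - θ)) * ∑ i ∈ S, z i / (z i - θ) := by
  rw [nodeSum, eval_finsetSum, Finset.mul_sum]
  refine Finset.sum_congr rfl fun i hi => ?_
  have := sub_ne_zero.mpr (hθ i hi).symm
  rw [← Finset.mul_prod_erase _ _ hi]
  simp only [eval_mul, eval_C, eval_prod, eval_sub, eval_X]
  field_simp

lemma eval_levelPoly (T : ℂ) (S : Finset ι) {θ : ℂ} (hθ : ∀ i ∈ S, θ ≠ z i) :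
    (levelPoly z T S).eval θ = (∏ i ∈ S, (z i - θ)) * (∑ i ∈ S, z i / (θ - z i) - T) := by
  have h : ∑ i ∈ S, z i / (θ - z i) = -∑ i ∈ S, z i / (z i - θ) := by
    rw [← Finset.sum_neg_distrib]
    refine Finset.sum_congr rfl fun i _ => ?_
    rw [← neg_sub (z i) θ, div_neg]
  rw [levelPoly, eval_neg, eval_add, eval_mul, eval_C, eval_nodeSum z S hθ, eval_nodeProd, h]
  ring

lemma natDegree_levelPoly {T : ℂ} (hT : T ≠ 0) (S : Finset ι) :
    (levelPoly z T S).natDegree = S.card := by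
  have hfac : ∀ i, (C (z i) - X).degree = 1 := fun i => by
    rw [← neg_sub, degree_neg, degree_X_sub_C]
  have hprod : ∀ S : Finset ι, (∏ i ∈ S, (C (z i) - X)).degree =
      ((S.card : ℕ) : WithBot ℕ) := fun S => by
    simp [degree_prod, hfac]
  have hA : (C T * nodeProd z S).degree = ((S.card : ℕ) : WithBot ℕ) := by
    rw [degree_C_mul hT, nodeProd, hprod]
  have hG : (nodeSum z S).degree < ((S.card : ℕ) : WithBot ℕ) := by
    refine (degree_sum_le _ _).trans_lt ((Finset.sup_lt_iff (WithBot.bot_lt_coe _)).mpr ?_)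
    intro i hi
    refine (degree_mul_le _ _).trans_lt ?_
    rw [hprod]
    refine (add_le_add_left degree_C_le _).trans_lt ?_
    rw [zero_add]
    exact_mod_cast Finset.card_erase_lt_of_mem hi
  rw [levelPoly, natDegree_neg]
  refine natDegree_eq_of_degree_eq_some ?_
  rw [degree_add_eq_right_of_degree_lt (by rwa [hA]), hA]

variable {z}

lemma cross_ne_zero (hz : Function.Injective z) (hz0 : ∀ i, z i ≠ 0) {S S' : Finset ι}
    (h : S ≠ S') : nodeSum z S * nodeProd z S' - nodeSum z S' * nodeProd z S ≠ 0 := by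
  have key : ∀ S S' : Finset ι, ∀ i ∈ S, i ∉ S' →
      nodeSum z S * nodeProd z S' - nodeSum z S' * nodeProd z S ≠ 0 := by
    intro S S' i hi hi' h0
    have := congrArg (eval (z i)) h0
    rw [eval_sub, eval_mul, eval_mul, eval_nodeProd_eq_zero z hi, mul_zero, sub_zero,
      eval_nodeSum_node z hi, eval_nodeProd, eval_zero] at this
    refine mul_ne_zero (mul_ne_zero (hz0 i) (prod_erase_sub_ne_zero z hz S i))
      (Finset.prod_ne_zero_iff.mpr fun j hj => sub_ne_zero.mpr (hz.ne ?_)) this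
    rintro rfl
    exact hi' hj
  by_cases hsub : S ⊆ S'
  · obtain ⟨i, hi, hi'⟩ := Finset.not_subset.mp fun h' => h (hsub.antisymm h')
    rw [← neg_sub, neg_ne_zero]
    exact key S' S i hi hi'
  · obtain ⟨i, hi, hi'⟩ := Finset.not_subset.mp hsub
    exact key S S' i hi hi'

lemma wronskian_nodeSum_nodeProd_ne_zero (hz : Function.Injective z) (hz0 : ∀ i, z i ≠ 0)
    {S : Finset ι} (hS : S.Nonempty) : wronskian (nodeSum z S) (nodeProd z S) ≠ 0 := by
  obtain ⟨i, hi⟩ := hS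
  intro h
  have := congrArg (eval (z i)) h
  rw [wronskian, eval_sub, eval_mul, eval_mul, eval_nodeProd_eq_zero z hi, mul_zero, sub_zero,
    eval_nodeSum_node z hi, eval_derivative_nodeProd_node z hi, eval_zero] at this
  have hne := prod_erase_sub_ne_zero z hz S i
  exact mul_ne_zero (mul_ne_zero (hz0 i) hne) (neg_ne_zero.mpr hne) this

/-- For a generic level `T` the roots of the polynomials `levelPoly z T S` are simple, pairwise
distinct, and avoid `0` and all nodes. -/
lemma exists_generic_level [Fintype ι] (hz : Function.Injective z) (hz0 : ∀ i, z i ≠ 0) :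
    ∃ T : ℂ, T ≠ 0 ∧ ∀ S θ, (levelPoly z T S).IsRoot θ → θ ≠ 0 ∧ (∀ i, θ ≠ z i) ∧
      (derivative (levelPoly z T S)).eval θ ≠ 0 ∧
      ∀ S', S' ≠ S → (levelPoly z T S').eval θ ≠ 0 := by
  let B : Finset ι → ℂ[X] := fun S => X * nodeProd z Finset.univ *
    wronskian (nodeSum z S) (nodeProd z S) *
    ∏ S' ∈ Finset.univ.erase S, (nodeSum z S * nodeProd z S' - nodeSum z S' * nodeProd z S)
  have hB : ∀ S : Finset ι, S.Nonempty → B S ≠ 0 := by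
    intro S hS
    refine mul_ne_zero (mul_ne_zero (mul_ne_zero X_ne_zero ?_)
      (wronskian_nodeSum_nodeProd_ne_zero hz hz0 hS)) ?_
    · refine Finset.prod_ne_zero_iff.mpr fun i _ h => ?_
      have := congrArg (eval (z i - 1)) h
      simp at this
    · exact Finset.prod_ne_zero_iff.mpr fun S' hS' =>
        cross_ne_zero hz hz0 (Finset.ne_of_mem_erase hS').symm
  obtain ⟨T, hT⟩ := Infinite.exists_notMem_finset (insert 0 (Finset.univ.biUnion fun S =>
    (B S).roots.toFinset.image fun θ => -(nodeSum z S).eval θ / (nodeProd z S).eval θ))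
  rw [Finset.mem_insert, not_or] at hT
  obtain ⟨hT0, hT⟩ := hT
  refine ⟨T, hT0, fun S θ hθ => ?_⟩
  have hroot : ∀ S', (levelPoly z T S').eval θ = 0 →
      (nodeSum z S').eval θ = -T * (nodeProd z S').eval θ := by
    intro S' h
    rw [levelPoly, eval_neg, eval_add, eval_mul, eval_C] at h
    linear_combination -h
  have hS : S.Nonempty := by
    rw [Finset.nonempty_iff_ne_empty]
    rintro rfl
    exact hT0 (by simpa [levelPoly, nodeSum, nodeProd] using hθ)
  have hGA := hroot S hθ
  have hA : (nodeProd z S).eval θ ≠ 0 := by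
    intro h
    rw [h, mul_zero] at hGA
    rw [eval_nodeProd, Finset.prod_eq_zero_iff] at h
    obtain ⟨i, hi, h⟩ := h
    rw [← sub_eq_zero.mp h, eval_nodeSum_node z hi] at hGA
    exact mul_ne_zero (hz0 i) (prod_erase_sub_ne_zero z hz S i) hGA
  have hBθ : (B S).eval θ ≠ 0 := by
    intro h
    refine hT (Finset.mem_biUnion.mpr ⟨S, Finset.mem_univ _, Finset.mem_image.mpr ⟨θ, ?_, ?_⟩⟩)
    · simpa [hB S hS] using h
    · rw [hGA]
      field_simp
  simp only [B, eval_mul, mul_ne_zero_iff, eval_X, eval_prod, Finset.prod_ne_zero_iff,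
    eval_nodeProd, Finset.mem_univ, true_implies] at hBθ
  obtain ⟨⟨⟨h0, hnode⟩, hwr⟩, hcross⟩ := hBθ
  refine ⟨h0, fun i => (sub_ne_zero.mp (hnode i)).symm, fun h => hwr ?_, fun S' hS' h =>
    hcross S' (Finset.mem_erase.mpr ⟨hS', Finset.mem_univ _⟩) ?_⟩
  · simp only [levelPoly, derivative_neg, derivative_add, derivative_C_mul, eval_neg, eval_add,
      eval_mul, eval_C] at h
    rw [wronskian, eval_sub, eval_mul, eval_mul, hGA]
    linear_combination (nodeProd z S).eval θ * h
  · rw [eval_sub, eval_mul, eval_mul, hGA, hroot S' h]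
    ring

end PartialFractions

section Example

variable {m : ℕ}

/-- Scalings at which the slice quadratics factor. -/
def splitScaling (z : Fin m → ℂ) : Fin m × Fin 2 × Fin 2 → ℂ :=
  fun t => if t.2 = (0, 1) then z t.1 else 1

/-- Data at which the slice quadratics factor. -/
def splitData (τ : ℂ) : Fin m × Fin 2 × Fin 2 → ℂ :=
  fun t => if t.2 = (0, 0) then 1 + τ else if t.2 = (1, 1) then τ else -τ

lemma eval_sliceLead_split (z : Fin m → ℂ) (θ : ℂ) (i : Fin m) :
    (sliceLead (splitScaling z) i).eval θ = z i - θ := by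
  simp [sliceLead, splitScaling]

lemma eval_discrim_split (z : Fin m → ℂ) (τ θ : ℂ) (i : Fin m) :
    (discrim (sliceLead (splitScaling z) i) (sliceMid (splitScaling z) (splitData τ) i)
      (sliceConst (splitScaling z) (splitData τ) i)).eval θ = z i ^ 2 := by
  simp [discrim, sliceLead, sliceMid, sliceConst, splitScaling, splitData]
  ring

lemma oddsPoly_split (z : Fin m → ℂ) (hz0 : ∀ i, z i ≠ 0) (τ : ℂ) :
    oddsPoly (splitScaling z) (splitData τ) =
      ∏ ε : Fin m → Fin 2, levelPoly z (m * τ) (Finset.univ.filter fun i => ε i = 1) := by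
  refine eq_of_infinite_eval_eq _ _ (Set.Infinite.mono ?_
    (Set.finite_range z).infinite_compl)
  intro θ hθ
  have hθz : ∀ i, θ ≠ z i := fun i h => hθ ⟨i, h.symm⟩
  have hne : ∀ i, θ - z i ≠ 0 := fun i => sub_ne_zero.mpr (hθz i)
  let r : Fin m → Fin 2 → ℂ := fun i b => (if b = 1 then z i / (θ - z i) else 0) - τ
  have hr : ∀ i b, (sliceLead (splitScaling z) i).eval θ * r i b ^ 2 +
      (sliceMid (splitScaling z) (splitData τ) i).eval θ * r i b +
      (sliceConst (splitScaling z) (splitData τ) i).eval θ = 0 := by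
    intro i b
    have := hne i
    rw [slice_quadratic]
    fin_cases b
    · simp [splitScaling, splitData, r]
    · simp [splitScaling, splitData, r]
      field_simp
      ring
  have hr' : ∀ i, r i 0 ≠ r i 1 := by
    intro i h
    have : z i / (θ - z i) = 0 := by
      simp only [r, zero_ne_one, if_false, if_true] at h
      linear_combination -h
    exact div_ne_zero (hz0 i) (hne i) this
  change eval θ _ = eval θ _
  rw [eval_oddsPoly, det_rootSumMatrix _ _ _ r hr hr', ← Finset.prod_mul_distrib, eval_prod]
  refine Finset.prod_congr rfl fun ε _ => ?_
  rw [eval_levelPoly z _ _ fun i _ => hθz i]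
  congr 1
  · rw [Finset.prod_filter]
    refine Finset.prod_congr rfl fun i _ => ?_
    rw [eval_sliceLead_split]
    generalize ε i = b
    fin_cases b <;> simp
  · simp [r, Finset.sum_sub_distrib, Finset.sum_filter]

lemma exists_generic_split (hm : 0 < m) : ∃ c u : Fin m × Fin 2 × Fin 2 → ℂ,
    (oddsPoly c u).coeff (m * 2 ^ (m - 1)) ≠ 0 ∧ IsCoprime (oddsPoly c u) (degeneracyPoly c u) := by
  let z : Fin m → ℂ := fun i => (i : ℕ) + 1
  have hz : Function.Injective z := by
    intro i j h
    simpa [z, Fin.ext_iff] using h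
  have hz0 : ∀ i, z i ≠ 0 := fun i => Nat.cast_add_one_ne_zero _
  obtain ⟨T, hT, hgen⟩ := exists_generic_level hz hz0
  have hm0 : (m : ℂ) ≠ 0 := by exact_mod_cast hm.ne'
  have hP := oddsPoly_split z hz0 (T / m)
  rw [mul_div_cancel₀ _ hm0] at hP
  refine ⟨splitScaling z, splitData (T / m), ?_, ?_⟩
  · have hne : ∀ S, levelPoly z T S ≠ 0 := by
      intro S h
      have := hgen S 0 (by simp [h])
      exact this.1 rfl
    have hdeg : (oddsPoly (splitScaling z) (splitData (T / m))).natDegree = m * 2 ^ (m - 1) := by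
      rw [hP, natDegree_prod _ _ fun ε _ => hne _, ← sum_sum_fin_two]
      refine Finset.sum_congr rfl fun ε _ => ?_
      rw [natDegree_levelPoly z hT, Finset.card_filter]
      refine Finset.sum_congr rfl fun i _ => ?_
      generalize ε i = b
      fin_cases b <;> simp
    rw [← hdeg, coeff_natDegree, leadingCoeff_ne_zero, hP]
    exact Finset.prod_ne_zero_iff.mpr fun ε _ => hne _
  · rw [isCoprime_iff_aeval_ne_zero_of_isAlgClosed ℂ ℂ]
    intro θ
    simp only [coe_aeval_eq_eval]
    rw [or_iff_not_imp_left, not_not]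
    intro hθ
    rw [hP, eval_prod, Finset.prod_eq_zero_iff] at hθ
    obtain ⟨ε, hε, hθ⟩ := hθ
    obtain ⟨h0, hnode, hder, hother⟩ := hgen _ _ hθ
    rw [degeneracyPoly, eval_mul, eval_mul, eval_mul, eval_X, eval_prod, eval_prod]
    simp only [eval_sliceLead_split, eval_discrim_split]
    refine mul_ne_zero (mul_ne_zero (mul_ne_zero h0
      (Finset.prod_ne_zero_iff.mpr fun i _ => sub_ne_zero.mpr (hnode i).symm))
      (Finset.prod_ne_zero_iff.mpr fun i _ => pow_ne_zero _ (hz0 i))) ?_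
    rw [hP, ← Finset.mul_prod_erase _ _ hε, derivative_mul, eval_add, eval_mul, eval_mul, hθ,
      zero_mul, add_zero, eval_prod]
    refine mul_ne_zero hder (Finset.prod_ne_zero_iff.mpr fun ε' hε' => hother _ fun h => ?_)
    refine Finset.ne_of_mem_erase hε' (funext fun i => ?_)
    have := congrArg (i ∈ ·) h
    simp only [Finset.mem_filter, Finset.mem_univ, true_and, eq_iff_iff] at this
    omega

/-- Generic coprimality and generic top degree are open conditions on the coefficients. -/
lemma exists_polynomial_of_generic {σ K : Type*} [Field K] (P Q : (MvPolynomial σ K)[X]) {N : ℕ}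
    (hN : N ≠ 0) (hP : P.natDegree ≤ N) (x : σ → K)
    (hlead : (P.map (MvPolynomial.eval x)).coeff N ≠ 0)
    (hcop : IsCoprime (P.map (MvPolynomial.eval x)) (Q.map (MvPolynomial.eval x))) :
    ∃ H : MvPolynomial σ K, H ≠ 0 ∧ ∀ y, MvPolynomial.eval y H ≠ 0 →
      (P.map (MvPolynomial.eval y)).coeff N ≠ 0 ∧
      ∀ θ, (P.map (MvPolynomial.eval y)).IsRoot θ →
        (Q.map (MvPolynomial.eval y)).eval θ ≠ 0 := by
  refine ⟨P.coeff N * resultant P Q N Q.natDegree, ?_, fun y hy => ?_⟩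
  · intro h
    have h := congrArg (MvPolynomial.eval x) h
    rw [map_mul, map_zero, ← coeff_map, ← resultant_map_map] at h
    have hdeg : (P.map (MvPolynomial.eval x)).natDegree = N :=
      natDegree_eq_of_le_of_coeff_ne_zero (natDegree_map_le.trans hP) hlead
    obtain ⟨k, hk⟩ := Nat.exists_eq_add_of_le
      (natDegree_map_le : (Q.map (MvPolynomial.eval x)).natDegree ≤ Q.natDegree)
    rw [hk, resultant_add_right_deg _ _ _ _ _ le_rfl] at h
    have hres := resultant_ne_zero _ _ hcop
    rw [hdeg] at hres
    exact mul_ne_zero hlead (mul_ne_zero (pow_ne_zero _ hlead) hres) h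
  · rw [map_mul, mul_ne_zero_iff] at hy
    refine ⟨by rw [coeff_map]; exact hy.1, fun θ hθ hQ => hy.2 ?_⟩
    obtain ⟨p, q, -, -, hpq⟩ := exists_mul_add_mul_eq_C_resultant P Q hP le_rfl (Or.inl hN)
    have h := congrArg (fun f => (f.map (MvPolynomial.eval y)).eval θ) hpq
    simp only [Polynomial.map_add, Polynomial.map_mul, eval_add, eval_mul, map_C, eval_C,
      hθ.eq_zero, hQ, zero_mul, add_zero] at h
    exact h.symm

end Example

/-- The degree of the toric variety `C_m` is `m·2^(m-1)`, attained as the ML degree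
for generic scalings: for generic `(c,u)` the likelihood system of the no-three-way
interaction model has exactly `m·2^(m-1)` solutions. -/
theorem generic_ml_degree_no_three_way (m : ℕ) (hm : 2 ≤ m) :
    ∃ H : MvPolynomial ((Fin m × Fin 2 × Fin 2) ⊕ (Fin m × Fin 2 × Fin 2)) ℂ,
      H ≠ 0 ∧
      ∀ c u : Fin m × Fin 2 × Fin 2 → ℂ, (∀ t, c t ≠ 0) →
        MvPolynomial.eval (Sum.elim c u) H ≠ 0 →
        (mlSolutions (c3A m) c u).Finite ∧
        (mlSolutions (c3A m) c u).ncard = m * 2 ^ (m - 1) := by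
  have hm0 : 0 < m := by omega
  let σ := Fin m × Fin 2 × Fin 2
  let cX : σ → MvPolynomial (σ ⊕ σ) ℂ := fun t => MvPolynomial.X (Sum.inl t)
  let uX : σ → MvPolynomial (σ ⊕ σ) ℂ := fun t => MvPolynomial.X (Sum.inr t)
  have hcX : ∀ c u : σ → ℂ, MvPolynomial.eval (Sum.elim c u) ∘ cX = c := fun c u => by
    funext t; simp [cX]
  have huX : ∀ c u : σ → ℂ, MvPolynomial.eval (Sum.elim c u) ∘ uX = u := fun c u => by
    funext t; simp [uX]
  obtain ⟨c₀, u₀, hlead, hcop⟩ := exists_generic_split hm0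
  obtain ⟨H, hH, hgen⟩ := exists_polynomial_of_generic (oddsPoly cX uX) (degeneracyPoly cX uX)
    (N := m * 2 ^ (m - 1)) (by positivity) (natDegree_oddsPoly_le _ _) (Sum.elim c₀ u₀)
    (by rwa [oddsPoly_map, hcX, huX])
    (by rwa [oddsPoly_map, degeneracyPoly_map, hcX, huX])
  refine ⟨H * (∑ t, uX t) * ∏ i, ∏ j, ∏ k : Fin 2, (uX (i, j, j) + uX (i, k, 1 - k)), ?_, ?_⟩
  · have hone : MvPolynomial.eval (Sum.elim c₀ (1 : σ → ℂ)) (∑ t, uX t) ≠ 0 := by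
      simp [uX, hm0.ne', σ]
    refine mul_ne_zero (mul_ne_zero hH fun h => hone (by rw [h, map_zero])) ?_
    simp only [Finset.prod_ne_zero_iff]
    intro i _ j _ k _ h
    have := congrArg (MvPolynomial.eval (Sum.elim c₀ (1 : σ → ℂ))) h
    norm_num [uX] at this
  · intro c u hc hH
    simp only [map_mul, mul_ne_zero_iff, map_prod, map_sum, map_add, Finset.prod_ne_zero_iff,
      Finset.mem_univ, true_implies] at hH
    obtain ⟨⟨hH, hu⟩, hmargin⟩ := hH
    obtain ⟨h1, h2⟩ := hgen _ hH
    rw [oddsPoly_map, hcX, huX] at h1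
    rw [oddsPoly_map, degeneracyPoly_map, hcX, huX] at h2
    refine ncard_mlSolutions hm0 c u hc ?_ ?_ h1 h2
    · simpa [uX] using hu
    · simpa [uX] using hmargin
end
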